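/- Let R ≥ 0 and h > 0, and let û, v̂ be Euclidean unit vectors of ℝ^d. If ‖û − v̂‖₂ ≤ (h/(2R))², then Cyl(v̂, h/2) ∩ B₂(R) ⊆ Cyl(û, h). Moreover, if in addition ‖û − v̂‖₂ ≤ 1/2, then Cyl₊(v̂, h/2) ∩ B₂(R) ∩ B₂(h)ᶜ ⊆ Cyl₊(û, h). -/

import Mathlib

open scoped RealInnerProductSpace

theorem dist_sq_aux {d : ℕ} (y u : EuclideanSpace ℝ (Fin d)) (hu : ‖u‖ = 1) (c : ℝ) :
    ‖y - ⟪y, u⟫ • u‖ ≤ ‖y - c • u‖ := by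
  apply le_of_sq_le_sq _ (norm_nonneg _)
  rw [norm_sub_sq_real, norm_sub_sq_real, norm_smul, norm_smul, hu, inner_smul_right,
    inner_smul_right]
  simp only [Real.norm_eq_abs, mul_one, sq_abs]
  nlinarith [sq_nonneg (c - ⟪y, u⟫)]

theorem first_aux {d : ℕ} (R h : ℝ) (hR : 0 ≤ R) (hh : 0 < h)
    (u v : EuclideanSpace ℝ (Fin d)) (hu : ‖u‖ = 1) (hv : ‖v‖ = 1)
    (huv : ‖u - v‖ ≤ (h / (2 * R)) ^ 2) (y : EuclideanSpace ℝ (Fin d))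
    (hy : ‖y - ⟪y, v⟫ • v‖ ≤ h / 2) (hyR : ‖y‖ ≤ R) : ‖y - ⟪y, u⟫ • u‖ ≤ h := by
  rcases le_or_gt R h with hRh | hRh
  · have := dist_sq_aux y u hu 0
    simp only [zero_smul, sub_zero] at this
    linarith
  · have hRpos : 0 < R := hh.trans hRh
    have h1 := dist_sq_aux y u hu ⟪y, v⟫
    have h2 : y - ⟪y, v⟫ • u = (y - ⟪y, v⟫ • v) - ⟪y, v⟫ • (u - v) := by
      rw [smul_sub]; abel
    have h3 : ‖y - ⟪y, v⟫ • u‖ ≤ ‖y - ⟪y, v⟫ • v‖ + |⟪y, v⟫| * ‖u - v‖ := by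
      rw [h2]
      refine (norm_sub_le _ _).trans ?_
      rw [norm_smul, Real.norm_eq_abs]
    have h4 : |⟪y, v⟫| ≤ R := by
      have := abs_real_inner_le_norm y v
      rw [hv, mul_one] at this
      exact this.trans hyR
    have h5 : |⟪y, v⟫| * ‖u - v‖ ≤ R * (h / (2 * R)) ^ 2 :=
      mul_le_mul h4 huv (norm_nonneg _) hR
    have h6 : R * (h / (2 * R)) ^ 2 = h * h / (4 * R) := by field_simp; ring
    have h7 : h * h / (4 * R) ≤ h / 2 := by
      rw [div_le_div_iff₀ (by positivity) (by positivity)]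
      nlinarith
    linarith

/-- Cylinder lemma: if `û, v̂` are Euclidean unit vectors with
`‖û − v̂‖ ≤ (h/(2R))²`, then `Cyl(v̂, h/2) ∩ B₂(R) ⊆ Cyl(û, h)`; moreover, if in
addition `‖û − v̂‖ ≤ 1/2`, then
`Cyl₊(v̂, h/2) ∩ B₂(R) ∩ B₂(h)ᶜ ⊆ Cyl₊(û, h)`. -/
theorem cylinder_inclusion (d : ℕ) (R h : ℝ) (hR : 0 ≤ R) (hh : 0 < h)
    (u v : EuclideanSpace ℝ (Fin d)) (hu : ‖u‖ = 1) (hv : ‖v‖ = 1)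
    (huv : ‖u - v‖ ≤ (h / (2 * R)) ^ 2) :
    ({y : EuclideanSpace ℝ (Fin d) | ‖y - ⟪y, v⟫ • v‖ ≤ h / 2} ∩ Metric.closedBall 0 R
        ⊆ {y | ‖y - ⟪y, u⟫ • u‖ ≤ h}) ∧
    (‖u - v‖ ≤ 1 / 2 →
      {y : EuclideanSpace ℝ (Fin d) | ‖y - ⟪y, v⟫ • v‖ ≤ h / 2 ∧ 0 ≤ ⟪y, v⟫} ∩
          Metric.closedBall 0 R ∩ (Metric.closedBall 0 h)ᶜ
        ⊆ {y | ‖y - ⟪y, u⟫ • u‖ ≤ h ∧ 0 ≤ ⟪y, u⟫}) := by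
  refine ⟨?_, ?_⟩
  · rintro y ⟨hy, hyR⟩
    exact first_aux R h hR hh u v hu hv huv y hy (by simpa using hyR)
  · rintro h12 y ⟨⟨⟨hy, hpos⟩, hyR⟩, hyh⟩
    refine ⟨first_aux R h hR hh u v hu hv huv y hy (by simpa using hyR), ?_⟩
    have hyh' : h < ‖y‖ := by simpa using hyh
    set a := ⟪y, v⟫ with ha
    set w := y - a • v with hw
    have hyw : y = w + a • v := by rw [hw]; abel
    have hvv : ⟪v, v⟫ = 1 := by rw [real_inner_self_eq_norm_sq, hv]; norm_num
    have hwv : ⟪w, v⟫ = 0 := by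
      rw [hw, inner_sub_left, real_inner_smul_left, hvv, ← ha]; ring
    have h1 : ‖y‖ ≤ ‖w‖ + a := by
      calc ‖y‖ = ‖w + a • v‖ := by rw [← hyw]
        _ ≤ ‖w‖ + ‖a • v‖ := norm_add_le _ _
        _ = ‖w‖ + a := by rw [norm_smul, hv, mul_one, Real.norm_eq_abs, abs_of_nonneg hpos]
    have h2 : ⟪y, u⟫ = ⟪w, u - v⟫ + a * ⟪v, u⟫ := by
      rw [inner_sub_right, hwv, sub_zero]
      conv_lhs => rw [hyw]
      rw [inner_add_left, real_inner_smul_left]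
    have h3 := abs_le.1 (abs_real_inner_le_norm w (u - v))
    have h4 : ‖w‖ * ‖u - v‖ ≤ h / 2 * (1 / 2) :=
      mul_le_mul hy h12 (norm_nonneg _) (by positivity)
    have h5 : 7 / 8 ≤ ⟪v, u⟫ := by
      have := norm_sub_sq_real u v
      rw [hu, hv, real_inner_comm] at this
      nlinarith [norm_nonneg (u - v)]
    have hy' : ‖w‖ ≤ h / 2 := hy
    change 0 ≤ ⟪y, u⟫
    rw [h2]
    nlinarith [h3.1]
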